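/- Let A and B be finitely generated free groups, u, v : A → B injective group homomorphisms, and H, K subgroups of B such that the homomorphism A ∗ H → B induced by u and the inclusion of H, and the homomorphism A ∗ K → B induced by v and the inclusion of K, are both isomorphisms (i.e. B is the internal free product of u(A) and H, and also of v(A) and K). Then there exists an automorphism φ of B such that φ ∘ u = v and φ(H) = K. In other words, the automorphism group Aut(B) acts transitively on the set of morphisms A → B of the category 𝒢. -/

import Mathlib

open CategoryTheory Limits
open scoped Classical TensorProduct

noncomputable section

/-- The free product of two free groups is free on the disjoint union of the generators. -/
def freeGroupCoprodEquiv (X Y : Type*) :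
    Monoid.Coprod (FreeGroup X) (FreeGroup Y) ≃* FreeGroup (X ⊕ Y) :=
  MonoidHom.toMulEquiv
    (Monoid.Coprod.lift (FreeGroup.map Sum.inl) (FreeGroup.map Sum.inr))
    (FreeGroup.lift (Sum.elim (fun x => Monoid.Coprod.inl (FreeGroup.of x))
      (fun y => Monoid.Coprod.inr (FreeGroup.of y))))
    (by ext <;> simp)
    (by ext x; cases x <;> simp)

/-- A free factor of a free group of finite rank `n` with a complement of rank `m` has a
finite set of free generators, of cardinality `d` with `m + d = n`. -/
theorem exists_freeGroup_mulEquiv_of_bijective_coprod_lift {m n : ℕ}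
    (u : FreeGroup (Fin m) →* FreeGroup (Fin n)) (H : Subgroup (FreeGroup (Fin n)))
    (hH : Function.Bijective (Monoid.Coprod.lift u H.subtype)) :
    ∃ d : ℕ, m + d = n ∧ Nonempty (FreeGroup (Fin d) ≃* H) := by
  let e : FreeGroup (Fin m ⊕ IsFreeGroup.Generators H) ≃* FreeGroup (Fin n) :=
    (freeGroupCoprodEquiv _ _).symm.trans
      ((MulEquiv.coprodCongr (MulEquiv.refl _) (IsFreeGroup.mulEquiv H)).trans
        (MulEquiv.ofBijective _ hH))
  have f : Fin m ⊕ IsFreeGroup.Generators H ≃ Fin n := Equiv.ofFreeGroupEquiv e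
  have : Finite (IsFreeGroup.Generators H) :=
    Finite.of_injective (fun x => f (Sum.inr x)) (f.injective.comp Sum.inr_injective)
  refine ⟨Nat.card (IsFreeGroup.Generators H), ?_, ⟨?_⟩⟩
  · simpa using Nat.card_congr f
  · exact (FreeGroup.freeGroupCongr (Finite.equivFin _).symm).trans (IsFreeGroup.mulEquiv H)

/-- **Lemma** (Djament–Vespa, proof of proposition 3.3, point (2)): the automorphism
group `Aut(B)` acts transitively on the morphisms `A → B` of the category `𝒢`.
If `B` is the internal free product of `u(A)` and `H`, and also of `v(A)` and `K`
(for injective homomorphisms `u, v : A → B` and subgroups `H, K ≤ B`), then there is an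
automorphism `φ` of `B` with `φ ∘ u = v` and `φ(H) = K`. -/
theorem aut_transitive_on_G_morphisms
    (m n : ℕ)
    (u v : FreeGroup (Fin m) →* FreeGroup (Fin n))
    (hu : Function.Injective u) (hv : Function.Injective v)
    (H K : Subgroup (FreeGroup (Fin n)))
    (hH : Function.Bijective (Monoid.Coprod.lift u H.subtype))
    (hK : Function.Bijective (Monoid.Coprod.lift v K.subtype)) :
    ∃ φ : MulAut (FreeGroup (Fin n)),
      φ.toMonoidHom.comp u = v ∧ H.map φ.toMonoidHom = K := by
  obtain ⟨d, hd, ⟨eH⟩⟩ := exists_freeGroup_mulEquiv_of_bijective_coprod_lift u H hH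
  obtain ⟨d', hd', ⟨eK⟩⟩ := exists_freeGroup_mulEquiv_of_bijective_coprod_lift v K hK
  obtain rfl : d = d' := by omega
  let e : H ≃* K := eH.symm.trans eK
  let a := MulEquiv.ofBijective _ hH
  let b := MulEquiv.ofBijective _ hK
  let φ : MulAut (FreeGroup (Fin n)) :=
    a.symm.trans ((MulEquiv.coprodCongr (MulEquiv.refl _) e).trans b)
  have hφ (x) : φ (a x) = b (MulEquiv.coprodCongr (MulEquiv.refl _) e x) :=
    congrArg (fun y => b (MulEquiv.coprodCongr (MulEquiv.refl _) e y)) (a.symm_apply_apply x)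
  have hφu (x) : φ (u x) = v x := hφ (Monoid.Coprod.inl x)
  have hφH (h : H) : φ h = e h := hφ (Monoid.Coprod.inr h)
  refine ⟨φ, MonoidHom.ext hφu, ?_⟩
  ext y
  constructor
  · rintro ⟨h, hh, rfl⟩
    exact (hφH ⟨h, hh⟩).symm ▸ (e ⟨h, hh⟩).2
  · intro hy
    refine ⟨e.symm ⟨y, hy⟩, (e.symm ⟨y, hy⟩).2, ?_⟩
    exact (hφH _).trans (congrArg Subtype.val (e.apply_symm_apply ⟨y, hy⟩))
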